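/- There exists a universal constant c > 0 with the following property. Let w, v ∈ ℝ^n be unit vectors with ρ = ⟨w,v⟩ ≥ 0, let f, g : ℝ → [0,1] be non-decreasing and left-continuous, and define F(x) = f(⟨w,x⟩) and G(x) = g(⟨v,x⟩) for x ∈ ℝ^n. Then Cov_γ(F, G) ≥ c · W₁^γ(F,G) / ( √(log(e / W₁^γ(F,F))) · √(log(e / W₁^γ(G,G))) ). -/

import Mathlib

open Finset MeasureTheory ProbabilityTheory

/-- The standard Gaussian measure `N(0, I_n)` on `ℝ^n`. -/
noncomputable def stdGaussian (n : ℕ) : Measure (Fin n → ℝ) :=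
  Measure.pi fun _ => gaussianReal 0 1

/-- Covariance of two functions under the standard Gaussian measure. -/
noncomputable def gaussCov (n : ℕ) (f g : (Fin n → ℝ) → ℝ) : ℝ :=
  (∫ x, f x * g x ∂stdGaussian n) -
    (∫ x, f x ∂stdGaussian n) * (∫ x, g x ∂stdGaussian n)

/-- `W₁^γ(F, G) = ∑ₖ E_γ[F · x_k] E_γ[G · x_k]` for functions `F, G : ℝ^n → ℝ`. -/
noncomputable def gaussW1F (n : ℕ) (F G : (Fin n → ℝ) → ℝ) : ℝ :=
  ∑ k, (∫ x, F x * x k ∂stdGaussian n) * (∫ x, G x * x k ∂stdGaussian n)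

local notation "γ" => gaussianReal 0 1

instance (n : ℕ) : IsProbabilityMeasure (stdGaussian n) := by
  unfold _root_.stdGaussian; infer_instance

noncomputable def linA {n : ℕ} (w v : Fin n → ℝ) : (Fin n → ℝ) →L[ℝ] ℝ × ℝ :=
  (∑ i, w i • ContinuousLinearMap.proj (R := ℝ) (φ := fun _ : Fin n => ℝ) i).prod
    (∑ i, v i • ContinuousLinearMap.proj (R := ℝ) (φ := fun _ : Fin n => ℝ) i)

lemma linA_apply {n : ℕ} (w v x : Fin n → ℝ) :
    linA w v x = (∑ i, w i * x i, ∑ i, v i * x i) := by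
  simp [linA]

noncomputable def linB (r s : ℝ) : ℝ × ℝ →L[ℝ] ℝ × ℝ :=
  (ContinuousLinearMap.fst ℝ ℝ ℝ).prod
    (r • ContinuousLinearMap.fst ℝ ℝ ℝ + s • ContinuousLinearMap.snd ℝ ℝ ℝ)

lemma linB_apply (r s : ℝ) (x : ℝ × ℝ) : linB r s x = (x.1, r * x.1 + s * x.2) := by
  simp [linB]

lemma cfd (L : StrongDual ℝ ℝ) : charFunDual γ L = Complex.exp (-(L 1)^2 / 2) := by
  have : charFunDual γ L = charFun γ (L 1) := by
    rw [charFunDual_apply, charFun_apply_real]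
    congr 1; ext x
    have : L x = L 1 * x := by
      conv_lhs => rw [show x = x • (1:ℝ) by simp, map_smul]
      simp [mul_comm]
    rw [this]; push_cast; rfl
  rw [this, charFun_gaussianReal]
  simp
  ring_nf

lemma law_eq {n : ℕ} (w v : Fin n → ℝ) (s : ℝ) (hw : ∑ i, w i ^ 2 = 1) (hv : ∑ i, v i ^ 2 = 1)
    (hs : (∑ i, w i * v i) ^ 2 + s ^ 2 = 1) :
    (stdGaussian n).map (linA w v) = (Measure.prod γ γ).map (linB (∑ i, w i * v i) s) := by
  have i1 := (linA w v).continuous.measurable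
  have i2 := (linB (∑ i, w i * v i) s).continuous.measurable
  have : IsProbabilityMeasure ((stdGaussian n).map (linA w v)) :=
    Measure.isProbabilityMeasure_map i1.aemeasurable
  have : IsProbabilityMeasure ((Measure.prod γ γ).map (linB (∑ i, w i * v i) s)) :=
    Measure.isProbabilityMeasure_map i2.aemeasurable
  apply Measure.ext_of_charFunDual
  ext L
  obtain ⟨p, q, hL⟩ : ∃ p q : ℝ, ∀ x, L x = p * x.1 + q * x.2 := by
    refine ⟨L (1,0), L (0,1), fun x => ?_⟩
    conv_lhs => rw [show x = x.1 • (1,0) + x.2 • (0,1) by ext <;> simp, map_add, map_smul, map_smul]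
    simp [mul_comm]
  rw [charFunDual_map, charFunDual_map, _root_.stdGaussian, charFunDual_pi, charFunDual_prod]
  simp only [cfd]
  rw [← Complex.exp_add, ← Complex.exp_sum]
  congr 1
  simp only [ContinuousLinearMap.comp_apply, linA_apply, linB_apply, hL,
    ContinuousLinearMap.inl_apply, ContinuousLinearMap.inr_apply, ContinuousLinearMap.single_apply]
  have e : ∀ i, (∑ j, w j * (Pi.single i (1:ℝ) : Fin n → ℝ) j) = w i := by
    intro i; simp [Pi.single_apply]
  have e' : ∀ i, (∑ j, v j * (Pi.single i (1:ℝ) : Fin n → ℝ) j) = v i := by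
    intro i; simp [Pi.single_apply]
  simp only [e, e']
  norm_cast
  have : ∑ i, (p * w i + q * v i) ^ 2 = p^2 + q^2 + 2 * p * q * ∑ i, w i * v i := by
    have : ∀ i, (p * w i + q * v i)^2 = p^2 * w i^2 + q^2 * v i^2 + 2*p*q*(w i * v i) := by
      intro i; ring
    simp_rw [this, sum_add_distrib, ← mul_sum, hw, hv]; ring
  push_cast
  rw [← sum_div]
  simp only [Finset.sum_neg_distrib]
  norm_cast
  rw [this]
  generalize (∑ i, w i * v i) = ρ at *
  linear_combination (q)^2/2 * hs

noncomputable def ph (x : ℝ) : ℝ := (√(2 * Real.pi))⁻¹ * Real.exp (-x ^ 2 / 2)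

lemma ph_eq : gaussianPDFReal 0 1 = ph := by
  ext x; simp [gaussianPDFReal, ph]

lemma ph_pos (x : ℝ) : 0 < ph x := by unfold ph; positivity

lemma ph_le_one (x : ℝ) : ph x ≤ 1 := by
  unfold ph
  have h1 : (√(2 * Real.pi))⁻¹ ≤ 1 := by
    apply inv_le_one_of_one_le₀
    rw [Real.one_le_sqrt]; nlinarith [Real.pi_gt_three]
  have h2 : Real.exp (-x ^ 2 / 2) ≤ 1 := by
    rw [Real.exp_le_one_iff]; nlinarith [sq_nonneg x]
  have := Real.exp_pos (-x ^ 2 / 2)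
  have : 0 ≤ (√(2 * Real.pi))⁻¹ := by positivity
  nlinarith

lemma ph_cont : Continuous ph := by unfold ph; fun_prop

noncomputable def ps (x : ℝ) : ℝ := ph x / √(1 + x ^ 2)

lemma sq_pos' (x : ℝ) : 0 < √(1 + x ^ 2) := by positivity
lemma ps_pos (x : ℝ) : 0 < ps x := div_pos (ph_pos x) (sq_pos' x)

lemma ps_cont : Continuous ps := by
  unfold ps
  exact ph_cont.div (by fun_prop) (fun x => (sq_pos' x).ne')

lemma ps_le_one (x : ℝ) : ps x ≤ 1 := by
  unfold ps
  rw [div_le_one (sq_pos' x)]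
  refine (ph_le_one x).trans ?_
  rw [Real.one_le_sqrt]; nlinarith [sq_nonneg x]

lemma int_ga (h : ℝ → ℝ) : ∫ x, h x ∂γ = ∫ x, ph x * h x := by
  rw [integral_gaussianReal_eq_integral_smul (by norm_num)]
  simp [ph_eq]

lemma ph_integrable : Integrable ph := by
  rw [← ph_eq]; exact integrable_gaussianPDFReal 0 1

lemma mills_aux (s a b : ℝ) (hab : a ≤ b) (h : ∀ x ∈ Set.Ioc a b, x ^ 2 ≤ s ^ 2 + 3) :
    Real.exp (-3/2) * ph s * (b - a) ≤ (γ).real (Set.Ioc a b) := by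
  rw [measureReal_def, gaussianReal_apply_eq_integral _ (by norm_num), ph_eq,
    ENNReal.toReal_ofReal (setIntegral_nonneg measurableSet_Ioc fun x _ => (ph_pos x).le)]
  have := setIntegral_ge_of_const_le_real (μ := volume) (s := Set.Ioc a b) (f := ph)
    (c := Real.exp (-3/2) * ph s) measurableSet_Ioc (by simp) (fun x hx => ?_)
    ph_integrable.integrableOn
  · simpa [measureReal_def, hab] using this
  · have := h x hx
    unfold ph
    rw [mul_left_comm, ← Real.exp_add]
    gcongr
    linarith

lemma step_props (s : ℝ) : 0 < (√(1 + s^2))⁻¹ ∧ (√(1 + s^2))⁻¹ ≤ 1 ∧ |s| * (√(1 + s^2))⁻¹ ≤ 1 := by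
  have h0 := sq_pos' s
  refine ⟨by positivity, inv_le_one_of_one_le₀ ?_, ?_⟩
  · rw [Real.one_le_sqrt]; nlinarith [sq_nonneg s]
  · rw [← div_eq_mul_inv, div_le_one h0]
    apply Real.le_sqrt_of_sq_le
    rw [sq_abs]; linarith

lemma mills_up (s : ℝ) : Real.exp (-3/2) * ps s ≤ (γ).real (Set.Ioi s) := by
  obtain ⟨h1, h2, h3⟩ := step_props s
  set d := (√(1 + s^2))⁻¹ with hd
  have := mills_aux s s (s + d) (by linarith) (fun x hx => by
    obtain ⟨y, rfl⟩ : ∃ y, x = s + y := ⟨x - s, by ring⟩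
    have y0 : 0 ≤ y := by linarith [hx.1]
    have y1 : y ≤ d := by linarith [hx.2]
    have : s * y ≤ 1 := calc
      s * y ≤ |s| * d := mul_le_mul (le_abs_self s) y1 y0 (abs_nonneg s)
      _ ≤ 1 := h3
    nlinarith)
  calc _ = Real.exp (-3/2) * ph s * (s + d - s) := by rw [ps, hd]; ring
    _ ≤ _ := this
    _ ≤ _ := measureReal_mono (fun x hx => hx.1)

lemma mills_dn (s : ℝ) : Real.exp (-3/2) * ps s ≤ (γ).real (Set.Iic s) := by
  obtain ⟨h1, h2, h3⟩ := step_props s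
  set d := (√(1 + s^2))⁻¹ with hd
  have := mills_aux s (s - d) s (by linarith) (fun x hx => by
    obtain ⟨y, rfl⟩ : ∃ y, x = s - y := ⟨s - x, by ring⟩
    have y0 : 0 ≤ y := by linarith [hx.2]
    have y1 : y ≤ d := by linarith [hx.1]
    have : (-s) * y ≤ 1 := calc
      (-s) * y ≤ |s| * d := mul_le_mul (neg_le_abs s) y1 y0 (abs_nonneg s)
      _ ≤ 1 := h3
    nlinarith)
  calc _ = Real.exp (-3/2) * ph s * (s - (s - d)) := by rw [ps, hd]; ring
    _ ≤ _ := this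
    _ ≤ _ := measureReal_mono (fun x hx => hx.2)

lemma K_lower (s r : ℝ) : Real.exp (-3/2) ^ 2 * (ps s * ps r) ≤
    (γ).real (Set.Ioi (max s r)) - (γ).real (Set.Ioi s) * (γ).real (Set.Ioi r) := by
  have hc : ∀ x, (γ).real (Set.Iic x) = 1 - (γ).real (Set.Ioi x) := by
    intro x
    rw [← Set.compl_Ioi, probReal_compl_eq_one_sub measurableSet_Ioi]
  have e := Real.exp_pos (-3/2)
  rcases le_total s r with h | h
  · rw [max_eq_right h]
    have := mul_le_mul (mills_up r) (mills_dn s) (mul_pos e (ps_pos s)).le measureReal_nonneg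
    rw [hc] at this
    nlinarith
  · rw [max_eq_left h]
    have := mul_le_mul (mills_up s) (mills_dn r) (mul_pos e (ps_pos r)).le measureReal_nonneg
    rw [hc] at this
    nlinarith

lemma alpha_Ioi (s : ℝ) : ∫ x, (Set.Ioi s).indicator 1 x * x ∂γ = ph s := by
  rw [int_ga]
  have : (fun x => ph x * ((Set.Ioi s).indicator 1 x * x)) =
      (Set.Ioi s).indicator (fun x => ph x * x) := by
    ext x; by_cases h : x ∈ Set.Ioi s <;> simp [h]
  rw [this, integral_indicator measurableSet_Ioi]
  have hd : ∀ x ∈ Set.Ici s, HasDerivAt (fun x => - ph x) (ph x * x) x := by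
    intro x _
    unfold ph
    have := ((((hasDerivAt_pow 2 x).neg).div_const 2).exp.const_mul ((√(2 * Real.pi))⁻¹)).neg
    convert! this using 1
    simp; ring
  have hi : Integrable (fun x => ph x * x) := by
    have := integrable_mul_exp_neg_mul_sq (b := 1/2) (by norm_num)
    have := this.const_mul ((√(2 * Real.pi))⁻¹)
    convert this using 2 with x
    unfold ph
    rw [show -x^2/2 = -(1/2) * x^2 by ring]; ring
  have ht : Filter.Tendsto (fun x => - ph x) Filter.atTop (nhds (-0)) := by
    apply Filter.Tendsto.neg
    unfold ph
    rw [← mul_zero ((√(2 * Real.pi))⁻¹)]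
    apply Filter.Tendsto.const_mul
    apply Real.tendsto_exp_atBot.comp
    have : Filter.Tendsto (fun x : ℝ => x^2 / 2) Filter.atTop Filter.atTop :=
      (Filter.tendsto_pow_atTop (by norm_num)).atTop_div_const (by norm_num)
    have := Filter.tendsto_neg_atTop_atBot.comp this
    refine this.congr fun x => ?_
    simp; ring
  rw [integral_Ioi_of_hasDerivAt_of_tendsto' hd hi.integrableOn ht]
  simp

noncomputable def c1 : ℝ := ∫ y, (√(1 + y ^ 2))⁻¹ ∂γ

lemma c1_integrable : Integrable (fun y : ℝ => (√(1 + y ^ 2))⁻¹) γ := by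
  apply Integrable.of_bound (C := 1)
  · exact (Continuous.inv₀ (by fun_prop) fun x => (sq_pos' x).ne').aestronglyMeasurable
  · filter_upwards with x
    rw [Real.norm_of_nonneg (step_props x).1.le]
    exact (step_props x).2.1

lemma c1_pos : 0 < c1 := by
  unfold c1
  rw [integral_pos_iff_support_of_nonneg (fun x => (step_props x).1.le) c1_integrable]
  have : Function.support (fun y : ℝ => (√(1 + y ^ 2))⁻¹) = Set.univ := by
    ext x; simp only [Function.mem_support, Set.mem_univ, iff_true]; exact (step_props x).1.ne'
  rw [this]; simp

lemma conv_lower (ρ σ t : ℝ) (hρ : 0 < ρ) (h : ρ ^ 2 + σ ^ 2 = 1) :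
    c1 * (ρ * ps t) ≤ ∫ z, ps ((t - σ * z) / ρ) ∂γ := by
  rw [int_ga]
  set F : ℝ → ℝ := fun z => ph z * ps ((t - σ * z) / ρ) with hF
  have e1 : ∫ z, F z = ρ * ∫ y, F (σ * t - ρ * y) := by
    have := Measure.integral_comp_mul_left (fun y => F (σ * t - y)) ρ
    rw [this, integral_sub_left_eq_self F volume (σ * t), abs_of_pos (by positivity)]
    rw [smul_eq_mul, mul_inv_cancel_left₀ hρ.ne']
  have e2 : ∀ y, F (σ * t - ρ * y) = ph y * (ph t * (√(1 + (ρ * t + σ * y) ^ 2))⁻¹) := by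
    intro y
    have : (t - σ * (σ * t - ρ * y)) / ρ = ρ * t + σ * y := by
      field_simp
      linear_combination (-t) * h
    simp only [hF, this, ps]
    rw [div_eq_mul_inv, ← mul_assoc, ← mul_assoc]
    congr 1
    unfold ph
    rw [mul_mul_mul_comm, ← Real.exp_add, mul_mul_mul_comm, ← Real.exp_add]
    congr 2
    linear_combination (-(t^2 + y^2)/2) * h
  rw [e1]; simp_rw [e2]
  rw [← int_ga, integral_const_mul]
  have : c1 * (√(1 + t^2))⁻¹ ≤ ∫ y, (√(1 + (ρ * t + σ * y) ^ 2))⁻¹ ∂γ := by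
    unfold c1
    rw [← integral_mul_const]
    apply integral_mono (c1_integrable.mul_const _)
    · apply Integrable.of_bound (C := 1)
      · exact (Continuous.inv₀ (by fun_prop) fun x => (sq_pos' _).ne').aestronglyMeasurable
      · filter_upwards with x
        rw [Real.norm_of_nonneg (step_props _).1.le]
        exact (step_props _).2.1
    · intro y
      simp only
      rw [← mul_inv, ← Real.sqrt_mul (by positivity)]
      apply inv_anti₀ (sq_pos' _)
      apply Real.sqrt_le_sqrt
      nlinarith [sq_nonneg (ρ * y - σ * t), sq_nonneg (y * t)]
  have h2 := mul_le_mul_of_nonneg_left this (mul_pos hρ (ph_pos t)).le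
  calc _ = ρ * ph t * (c1 * (√(1 + t ^ 2))⁻¹) := by unfold ps; ring
    _ ≤ _ := h2
    _ = _ := by ring

lemma law_Y (ρ σ : ℝ) (h : ρ ^ 2 + σ ^ 2 = 1) :
    (Measure.prod γ γ).map (fun p : ℝ × ℝ => ρ * p.1 + σ * p.2) = γ := by
  let L : ℝ × ℝ →L[ℝ] ℝ := ρ • ContinuousLinearMap.fst ℝ ℝ ℝ + σ • ContinuousLinearMap.snd ℝ ℝ ℝ
  have hL : (fun p : ℝ × ℝ => ρ * p.1 + σ * p.2) = L := by ext p; simp [L]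
  have i2 := L.continuous.measurable
  rw [hL]
  have : IsProbabilityMeasure ((Measure.prod γ γ).map L) :=
    Measure.isProbabilityMeasure_map i2.aemeasurable
  apply Measure.ext_of_charFunDual
  ext M
  have hM : ∀ x, M x = M 1 * x := by
    intro x
    conv_lhs => rw [show x = x • (1:ℝ) by simp, map_smul]
    simp [mul_comm]
  rw [charFunDual_map, charFunDual_prod]
  simp only [cfd]
  rw [← Complex.exp_add]
  congr 1
  simp only [ContinuousLinearMap.comp_apply, ← hL,
    ContinuousLinearMap.inl_apply, ContinuousLinearMap.inr_apply]
  rw [hM (ρ * 1 + σ * 0), hM (ρ * 0 + σ * 1)]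
  norm_cast
  linear_combination (-(M 1)^2/2) * h

noncomputable def cv {Ω : Type*} [MeasurableSpace Ω] (μ : Measure Ω) (F G : Ω → ℝ) : ℝ :=
  (∫ x, F x * G x ∂μ) - (∫ x, F x ∂μ) * (∫ x, G x ∂μ)

lemma cv_symm {Ω : Type*} [MeasurableSpace Ω] (μ : Measure Ω) (F G : Ω → ℝ) :
    cv μ F G = cv μ G F := by
  unfold cv; simp_rw [mul_comm]

noncomputable def Iu (u y : ℝ) : ℝ := (Set.Ioi u).indicator (1 : ℝ → ℝ) y

lemma Iu_of_lt {u y : ℝ} (h : u < y) : Iu u y = 1 := by simp [Iu, h]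
lemma Iu_of_le {u y : ℝ} (h : y ≤ u) : Iu u y = 0 := by simp [Iu, h]

lemma Iu_mem (u y : ℝ) : 0 ≤ Iu u y ∧ Iu u y ≤ 1 := by
  rcases lt_or_ge u y with h | h
  · simp [Iu_of_lt h]
  · simp [Iu_of_le h]

lemma Iu_meas (u : ℝ) : Measurable (Iu u) := by
  unfold Iu; exact measurable_one.indicator measurableSet_Ioi

lemma Iu_meas2 : Measurable (fun p : ℝ × ℝ => Iu p.1 p.2) := by
  have : (fun p : ℝ × ℝ => Iu p.1 p.2) = {p : ℝ × ℝ | p.1 < p.2}.indicator 1 := by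
    ext p; simp [Iu, Set.indicator]
  rw [this]
  exact measurable_one.indicator (measurableSet_lt measurable_fst measurable_snd)

lemma Iu_int (y : ℝ) (h0 : 0 ≤ y) (h1 : y ≤ 1) : ∫ u in Set.Ioc (0:ℝ) 1, Iu u y = y := by
  have : (fun u => Iu u y) = (Set.Iio y).indicator 1 := by
    ext u; simp [Iu, Set.indicator]
  rw [this, setIntegral_indicator measurableSet_Iio]
  have : Set.Ioc (0:ℝ) 1 ∩ Set.Iio y = Set.Ioo 0 y := by
    ext x; simp only [Set.mem_inter_iff, Set.mem_Ioc, Set.mem_Iio, Set.mem_Ioo]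
    constructor
    · rintro ⟨⟨a, b⟩, c⟩; exact ⟨a, c⟩
    · rintro ⟨a, c⟩; exact ⟨⟨a, by linarith⟩, c⟩
  rw [this]; simp [h0]

section layer
variable {Ω : Type*} [MeasurableSpace Ω] (μ : Measure Ω) [IsProbabilityMeasure μ]

lemma layer_aux (F H : Ω → ℝ) (hF : Measurable F) (hH : Integrable H μ) :
    Integrable (fun p : ℝ × Ω => Iu p.1 (F p.2) * H p.2)
      ((volume.restrict (Set.Ioc (0:ℝ) 1)).prod μ) := by
  have h1 : Integrable (fun p : ℝ × Ω => H p.2) ((volume.restrict (Set.Ioc (0:ℝ) 1)).prod μ) :=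
    hH.comp_snd _
  have hm : Measurable (fun p : ℝ × Ω => Iu p.1 (F p.2)) :=
    Iu_meas2.comp (measurable_fst.prodMk (hF.comp measurable_snd))
  refine h1.bdd_mul (c := 1) hm.aestronglyMeasurable ?_
  filter_upwards with p
  rw [Real.norm_of_nonneg (Iu_mem _ _).1]; exact (Iu_mem _ _).2

lemma layer_integrable (F H : Ω → ℝ) (hF : Measurable F) (hH : Integrable H μ) :
    IntegrableOn (fun u => ∫ x, Iu u (F x) * H x ∂μ) (Set.Ioc (0:ℝ) 1) :=
  (layer_aux μ F H hF hH).integral_prod_left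

lemma layer (F H : Ω → ℝ) (hF : Measurable F) (hH : Integrable H μ)
    (hb : ∀ x, 0 ≤ F x ∧ F x ≤ 1) :
    ∫ u in Set.Ioc (0:ℝ) 1, (∫ x, Iu u (F x) * H x ∂μ) = ∫ x, F x * H x ∂μ := by
  rw [integral_integral_swap (layer_aux μ F H hF hH)]
  congr 1; ext x
  rw [integral_mul_const, Iu_int _ (hb x).1 (hb x).2]

lemma cv_layer_integrable (F G : Ω → ℝ) (hF : Measurable F) (hG : Integrable G μ) :
    IntegrableOn (fun u => cv μ (fun x => Iu u (F x)) G) (Set.Ioc (0:ℝ) 1) := by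
  have h1 := layer_integrable μ F G hF hG
  have h2 := layer_integrable μ F (fun _ => 1) hF (integrable_const 1)
  simp only [mul_one] at h2
  exact h1.sub (h2.mul_const _)

lemma cv_layer (F G : Ω → ℝ) (hF : Measurable F) (hG : Integrable G μ)
    (hb : ∀ x, 0 ≤ F x ∧ F x ≤ 1) :
    ∫ u in Set.Ioc (0:ℝ) 1, cv μ (fun x => Iu u (F x)) G = cv μ F G := by
  have h1 := layer_integrable μ F G hF hG
  have h2 := layer_integrable μ F (fun _ => 1) hF (integrable_const 1)
  have e2 := layer μ F (fun _ => 1) hF (integrable_const 1) hb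
  simp only [mul_one] at h2 e2
  unfold cv
  rw [integral_sub h1 (h2.mul_const _), integral_mul_const, e2, layer μ F G hF hG hb]

end layer

noncomputable def hh (x : ℝ) : ℝ := x / √(Real.log (Real.exp 1 / x ^ 2))

lemma hh_nonneg {x : ℝ} (h : 0 ≤ x) : 0 ≤ hh x := by unfold hh; positivity

lemma log_e_div {x : ℝ} (h : 0 < x) : Real.log (Real.exp 1 / x ^ 2) = 1 - 2 * Real.log x := by
  rw [Real.log_div (Real.exp_pos 1).ne' (by positivity), Real.log_exp, Real.log_pow]; simp

lemma hh_ph (s : ℝ) : hh (ph s) ≤ ps s := by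
  unfold hh ps
  rw [log_e_div (ph_pos s)]
  apply div_le_div_of_nonneg_left (ph_pos s).le (sq_pos' s)
  apply Real.sqrt_le_sqrt
  unfold ph
  rw [Real.log_mul (by positivity) (Real.exp_pos _).ne', Real.log_exp, Real.log_inv]
  have : 0 ≤ Real.log (√(2 * Real.pi)) := by
    apply Real.log_nonneg
    rw [Real.one_le_sqrt]; nlinarith [Real.pi_gt_three]
  linarith

lemma jens (α a : ℝ) (h0 : 0 ≤ α) (h1 : α ≤ 1) (ha0 : 0 ≤ a) (ha1 : a ≤ 1) :
    (α - a / 2) / (2 * √(Real.log (Real.exp 1 / a ^ 2))) ≤ hh α := by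
  rcases lt_or_ge α (a / 2) with h | h
  · refine le_trans ?_ (hh_nonneg h0)
    apply div_nonpos_of_nonpos_of_nonneg (by linarith) (by positivity)
  rcases ha0.eq_or_lt with rfl | ha
  · simpa using hh_nonneg h0
  have hα : 0 < α := by linarith
  unfold hh
  have hl : Real.log a ≤ 0 := Real.log_nonpos ha0 ha1
  have hlα : Real.log α ≤ 0 := Real.log_nonpos h0 h1
  have hcmp : Real.log a - 1 ≤ Real.log α := by
    have : Real.log (a / 2) ≤ Real.log α := Real.log_le_log (by linarith) h
    rw [Real.log_div ha.ne' (by norm_num)] at this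
    have := Real.log_two_lt_d9
    linarith
  rw [log_e_div ha, log_e_div hα]
  have e : 2 * √(1 - 2 * Real.log a) = √(4 * (1 - 2 * Real.log a)) := by
    rw [Real.sqrt_mul (by norm_num), show (4:ℝ) = 2 ^ 2 by norm_num, Real.sqrt_sq (by norm_num)]
  have hp : 0 < √(1 - 2 * Real.log α) := by apply Real.sqrt_pos.2; linarith
  apply div_le_div₀ h0 (by linarith) hp
  rw [e]
  apply Real.sqrt_le_sqrt
  linarith

lemma jint (α D : ℝ → ℝ) (a C : ℝ) (hC : 0 ≤ C) (h0 : ∀ u, 0 ≤ α u ∧ α u ≤ 1)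
    (hα : IntegrableOn α (Set.Ioc (0:ℝ) 1)) (hD : IntegrableOn D (Set.Ioc (0:ℝ) 1))
    (ha : ∫ u in Set.Ioc (0:ℝ) 1, α u = a) (hle : ∀ u, C * hh (α u) ≤ D u) :
    C * hh a / 4 ≤ ∫ u in Set.Ioc (0:ℝ) 1, D u := by
  have ha0 : 0 ≤ a := by
    rw [← ha]; exact setIntegral_nonneg measurableSet_Ioc fun u _ => (h0 u).1
  have ha1 : a ≤ 1 := by
    rw [← ha]
    calc _ ≤ ∫ u in Set.Ioc (0:ℝ) 1, (1:ℝ) :=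
          integral_mono hα (integrable_const 1) fun u => (h0 u).2
      _ = 1 := by simp
  set S := 2 * √(Real.log (Real.exp 1 / a ^ 2)) with hS
  have h1 : ∫ u in Set.Ioc (0:ℝ) 1, C * ((α u - a / 2) / S) = C * hh a / 4 := by
    rw [integral_const_mul, integral_div, integral_sub hα (integrable_const _), ha]
    simp [hS, hh]
    ring
  rw [← h1]
  apply integral_mono (((hα.sub (integrable_const _)).div_const S).const_mul C) hD
  intro u
  exact (mul_le_mul_of_nonneg_left (jens _ _ (h0 u).1 (h0 u).2 ha0 ha1) hC).trans (hle u)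

def Ray (a : ℝ → ℝ) : Prop :=
  (a = fun _ => 0) ∨ (a = fun _ => 1) ∨ ∃ s, a =ᵐ[γ] Iu s

lemma ray_of_mono (f : ℝ → ℝ) (hf : Monotone f) (u : ℝ) : Ray (fun x => Iu u (f x)) := by
  by_cases h1 : ∀ x, f x ≤ u
  · left; ext x; exact Iu_of_le (h1 x)
  by_cases h2 : ∀ x, u < f x
  · right; left; ext x; exact Iu_of_lt (h2 x)
  push Not at h1 h2
  obtain ⟨x1, h1⟩ := h1
  obtain ⟨x2, h2⟩ := h2
  right; right
  have hne : {x | u < f x}.Nonempty := ⟨x1, h1⟩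
  have hbd : BddBelow {x | u < f x} := ⟨x2, fun y hy => by
    by_contra hc
    have := hf (not_le.1 hc).le
    have hy : u < f y := hy
    linarith⟩
  refine ⟨sInf {x | u < f x}, ?_⟩
  have hna : NullSingletonClass γ := nullSingletonClass_gaussianReal (by norm_num)
  have hn : ∀ᵐ x ∂γ, x ≠ sInf {x | u < f x} := by
    rw [ae_iff]; simp only [ne_eq, not_not, Set.setOf_eq_eq_singleton]
    exact measure_singleton _
  filter_upwards [hn] with x hx
  rcases lt_or_gt_of_ne hx with h | h
  · rw [Iu_of_le h.le, Iu_of_le]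
    by_contra hc
    exact absurd (csInf_le hbd (not_le.1 hc)) (not_le.2 h)
  · rw [Iu_of_lt h, Iu_of_lt]
    obtain ⟨y, hy, hyx⟩ := exists_lt_of_csInf_lt hne h
    exact lt_of_lt_of_le hy (hf hyx.le)

lemma alpha_Iu (s : ℝ) : ∫ x, Iu s x * x ∂γ = ph s := alpha_Ioi s

lemma alpha_mem (a : ℝ → ℝ) (ha : Ray a) : 0 ≤ ∫ x, a x * x ∂γ ∧ ∫ x, a x * x ∂γ ≤ 1 := by
  rcases ha with rfl | rfl | ⟨s, hs⟩
  · simp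
  · simp
  · have : ∫ x, a x * x ∂γ = ph s := by
      rw [← alpha_Iu]
      apply integral_congr_ae
      filter_upwards [hs] with x hx
      rw [hx]
    rw [this]; exact ⟨(ph_pos s).le, ph_le_one s⟩

lemma int_Iu (s : ℝ) : ∫ x, Iu s x ∂γ = (γ).real (Set.Ioi s) := by
  unfold Iu; rw [integral_indicator_one measurableSet_Ioi]

lemma Iu_mul (s r x : ℝ) : Iu s x * Iu r x = Iu (max s r) x := by
  rcases lt_or_ge s x with h | h <;> rcases lt_or_ge r x with h' | h'
  · rw [Iu_of_lt h, Iu_of_lt h', Iu_of_lt (max_lt h h')]; simp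
  · rw [Iu_of_le h', Iu_of_le (h'.trans (le_max_right _ _))]; simp
  · rw [Iu_of_le h, Iu_of_le (h.trans (le_max_left _ _))]; simp
  · rw [Iu_of_le h, Iu_of_le (h.trans (le_max_left _ _))]; simp

noncomputable def kap : ℝ := Real.exp (-3/2) ^ 2 * c1

lemma kap_pos : 0 < kap := mul_pos (by positivity) c1_pos

lemma half_main (ρ σ s t : ℝ) (hρ : 0 < ρ) (h : ρ ^ 2 + σ ^ 2 = 1) :
    kap * ρ * (ps s * ps t) ≤ cv (Measure.prod γ γ) (fun p => Iu s p.1)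
      (fun p => Iu t (ρ * p.1 + σ * p.2)) := by
  have hY : ∀ x z, Iu t (ρ * x + σ * z) = Iu ((t - σ * z) / ρ) x := by
    intro x z
    rcases lt_or_ge ((t - σ * z) / ρ) x with h | h
    · rw [Iu_of_lt h, Iu_of_lt]
      rw [div_lt_iff₀ hρ] at h; linarith
    · rw [Iu_of_le h, Iu_of_le]
      rw [le_div_iff₀ hρ] at h; linarith
  have m1 : Measurable (fun p : ℝ × ℝ => Iu s p.1) := (Iu_meas s).comp measurable_fst
  have m2 : Measurable (fun p : ℝ × ℝ => Iu t (ρ * p.1 + σ * p.2)) :=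
    (Iu_meas t).comp (by fun_prop)
  have i2 : Integrable (fun p : ℝ × ℝ => Iu t (ρ * p.1 + σ * p.2)) (Measure.prod γ γ) := by
    apply Integrable.of_bound (C := 1) m2.aestronglyMeasurable
    filter_upwards with p
    rw [Real.norm_of_nonneg (Iu_mem _ _).1]; exact (Iu_mem _ _).2
  have i12 : Integrable (fun p : ℝ × ℝ => Iu s p.1 * Iu t (ρ * p.1 + σ * p.2))
      (Measure.prod γ γ) := by
    refine i2.bdd_mul (c := 1) m1.aestronglyMeasurable ?_
    filter_upwards with p
    rw [Real.norm_of_nonneg (Iu_mem _ _).1]; exact (Iu_mem _ _).2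
  have j2 := i2.integral_prod_right
  have j12 := i12.integral_prod_right
  unfold cv
  rw [integral_prod_symm _ i2, integral_prod_symm _ i12,
    integral_fun_fst (μ := γ) (ν := γ) (fun x => Iu s x)]
  simp only [hY, Iu_mul, int_Iu] at j2 j12 ⊢
  simp only [probReal_univ, one_smul]
  rw [← integral_const_mul, ← integral_sub j12 (j2.const_mul _)]
  have key := conv_lower ρ σ t hρ h
  calc kap * ρ * (ps s * ps t) = Real.exp (-3/2)^2 * ps s * (c1 * (ρ * ps t)) := by
        unfold kap; ring
    _ ≤ Real.exp (-3/2)^2 * ps s * ∫ z, ps ((t - σ * z) / ρ) ∂γ :=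
        mul_le_mul_of_nonneg_left key (mul_pos (by positivity) (ps_pos s)).le
    _ = ∫ z, Real.exp (-3/2)^2 * ps s * ps ((t - σ * z) / ρ) ∂γ := by rw [integral_const_mul]
    _ ≤ _ := by
        apply integral_mono _ (j12.sub (j2.const_mul _))
        · intro z
          have := K_lower s ((t - σ * z) / ρ)
          simp only [Pi.sub_apply]
          linarith
        · apply Integrable.const_mul
          apply Integrable.of_bound (C := 1)
          · exact (ps_cont.comp (by fun_prop)).aestronglyMeasurable
          · filter_upwards with x
            rw [Real.norm_of_nonneg (ps_pos _).le]
            exact ps_le_one _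

lemma half (ρ σ : ℝ) (a b : ℝ → ℝ) (hρ : 0 ≤ ρ) (h : ρ ^ 2 + σ ^ 2 = 1) (ha : Ray a) (hb : Ray b) :
    kap * ρ * (hh (∫ x, a x * x ∂γ) * hh (∫ x, b x * x ∂γ)) ≤
      cv (Measure.prod γ γ) (fun p => a p.1) (fun p => b (ρ * p.1 + σ * p.2)) := by
  have h00 : hh 0 = 0 := by simp [hh]
  rcases hρ.eq_or_lt with rfl | hρ
  · simp only [mul_zero, zero_mul, zero_add]
    unfold cv
    rw [integral_prod_mul (fun x => a x) (fun z => b (σ * z)), integral_fun_fst (fun x => a x),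
      integral_fun_snd (fun z => b (σ * z))]
    simp
  rcases ha with rfl | rfl | ⟨s, hs⟩
  · simp [h00, cv]
  · simp [h00, cv]
  rcases hb with rfl | rfl | ⟨t, ht⟩
  · simp [h00, cv]
  · simp [h00, cv]
  have ea : ∫ x, a x * x ∂γ = ph s := by
    rw [← alpha_Iu]
    apply integral_congr_ae
    filter_upwards [hs] with x hx
    rw [hx]
  have eb : ∫ x, b x * x ∂γ = ph t := by
    rw [← alpha_Iu]
    apply integral_congr_ae
    filter_upwards [ht] with x hx
    rw [hx]
  have hs2 : (fun p : ℝ × ℝ => a p.1) =ᵐ[Measure.prod γ γ] fun p => Iu s p.1 :=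
    Measure.quasiMeasurePreserving_fst.ae_eq_comp hs
  have ht2 : (fun p : ℝ × ℝ => b (ρ * p.1 + σ * p.2)) =ᵐ[Measure.prod γ γ]
      fun p => Iu t (ρ * p.1 + σ * p.2) := by
    have : Measure.QuasiMeasurePreserving (fun p : ℝ × ℝ => ρ * p.1 + σ * p.2)
      (Measure.prod γ γ) γ := ⟨by fun_prop, by rw [law_Y ρ σ h]⟩
    exact this.ae_eq_comp ht
  have ec : cv (Measure.prod γ γ) (fun p => a p.1) (fun p => b (ρ * p.1 + σ * p.2)) =
      cv (Measure.prod γ γ) (fun p => Iu s p.1) (fun p => Iu t (ρ * p.1 + σ * p.2)) := by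
    have e1 := integral_congr_ae hs2
    have e2 := integral_congr_ae ht2
    have e3 := integral_congr_ae (hs2.mul ht2)
    simp only [Pi.mul_apply] at e3
    unfold cv
    simp only
    rw [e1, e2, e3]
  rw [ea, eb, ec]
  refine le_trans ?_ (half_main ρ σ s t hρ h)
  apply mul_le_mul_of_nonneg_left _ (mul_pos kap_pos hρ).le
  exact mul_le_mul (hh_ph s) (hh_ph t) (hh_nonneg (ph_pos t).le) (ps_pos s).le

lemma bdd_integrable {Ω : Type*} [MeasurableSpace Ω] (μ : Measure Ω) [IsProbabilityMeasure μ]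
    (F : Ω → ℝ) (hF : Measurable F) (hb : ∀ x, 0 ≤ F x ∧ F x ≤ 1) : Integrable F μ := by
  apply Integrable.of_bound (C := 1) hF.aestronglyMeasurable
  filter_upwards with p
  rw [Real.norm_of_nonneg (hb p).1]; exact (hb p).2

lemma id_integrable : Integrable (fun x : ℝ => x) γ :=
  (memLp_id_gaussianReal (μ := 0) (v := 1) 1).integrable (by simp)

lemma main2 (ρ σ : ℝ) (f g : ℝ → ℝ) (hρ : 0 ≤ ρ) (h : ρ ^ 2 + σ ^ 2 = 1)
    (hf : Monotone f) (hg : Monotone g) (bf : ∀ x, 0 ≤ f x ∧ f x ≤ 1)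
    (bg : ∀ x, 0 ≤ g x ∧ g x ≤ 1) :
    kap / 16 * ρ * (hh (∫ x, f x * x ∂γ) * hh (∫ x, g x * x ∂γ)) ≤
      cv (Measure.prod γ γ) (fun p => f p.1) (fun p => g (ρ * p.1 + σ * p.2)) := by
  have mF : Measurable (fun p : ℝ × ℝ => f p.1) := hf.measurable.comp measurable_fst
  have mG : Measurable (fun p : ℝ × ℝ => g (ρ * p.1 + σ * p.2)) :=
    hg.measurable.comp (by fun_prop)
  have iG := bdd_integrable (Measure.prod γ γ) _ mG (fun p => bg _)
  have hb0 : 0 ≤ hh (∫ x, g x * x ∂γ) := by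
    apply hh_nonneg
    rw [← layer γ g _ hg.measurable id_integrable bg]
    exact setIntegral_nonneg measurableSet_Ioc fun u _ => (alpha_mem _ (ray_of_mono g hg u)).1
  rw [← cv_layer _ _ _ mF iG (fun p => bf _)]
  have := jint (fun u => ∫ x, Iu u (f x) * x ∂γ)
    (fun u => cv (Measure.prod γ γ) (fun p => Iu u (f p.1)) (fun p => g (ρ * p.1 + σ * p.2)))
    (∫ x, f x * x ∂γ) (kap / 4 * ρ * hh (∫ x, g x * x ∂γ))
    (mul_nonneg (mul_nonneg (by linarith [kap_pos]) hρ) hb0)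
    (fun u => alpha_mem _ (ray_of_mono f hf u))
    (layer_integrable γ f _ hf.measurable id_integrable)
    (cv_layer_integrable _ _ _ mF iG)
    (layer γ f _ hf.measurable id_integrable bf) ?_
  · refine le_trans (le_of_eq ?_) this
    ring
  intro u
  have mI : Measurable (fun p : ℝ × ℝ => Iu u (f p.1)) := (Iu_meas u).comp mF
  have iI := bdd_integrable (Measure.prod γ γ) _ mI (fun p => Iu_mem _ _)
  rw [cv_symm, ← cv_layer _ _ _ mG iI (fun p => bg _)]
  have := jint (fun v => ∫ x, Iu v (g x) * x ∂γ)
    (fun v => cv (Measure.prod γ γ) (fun p => Iu v (g (ρ * p.1 + σ * p.2)))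
      (fun p => Iu u (f p.1)))
    (∫ x, g x * x ∂γ) (kap * ρ * hh (∫ x, Iu u (f x) * x ∂γ))
    (mul_nonneg (mul_nonneg kap_pos.le hρ) (hh_nonneg (alpha_mem _ (ray_of_mono f hf u)).1))
    (fun v => alpha_mem _ (ray_of_mono g hg v))
    (layer_integrable γ g _ hg.measurable id_integrable)
    (cv_layer_integrable _ _ _ mG iI)
    (layer γ g _ hg.measurable id_integrable bg) ?_
  · refine le_trans (le_of_eq ?_) this
    ring
  intro v
  have := half ρ σ _ _ hρ h (ray_of_mono f hf u) (ray_of_mono g hg v)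
  rw [cv_symm]
  refine le_trans (le_of_eq ?_) this
  ring

lemma transfer {n : ℕ} (w v : Fin n → ℝ) (s : ℝ) (hw : ∑ i, w i ^ 2 = 1) (hv : ∑ i, v i ^ 2 = 1)
    (hs : (∑ i, w i * v i) ^ 2 + s ^ 2 = 1) (Φ : ℝ × ℝ → ℝ) (hΦ : Measurable Φ) :
    ∫ x, Φ (∑ i, w i * x i, ∑ i, v i * x i) ∂(_root_.stdGaussian n) =
      ∫ p, Φ (p.1, (∑ i, w i * v i) * p.1 + s * p.2) ∂(Measure.prod γ γ) := by
  have e := law_eq w v s hw hv hs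
  have h1 := integral_map (μ := _root_.stdGaussian n) (φ := linA w v) (f := Φ)
    (linA w v).continuous.measurable.aemeasurable hΦ.aestronglyMeasurable
  have h2 := integral_map (μ := Measure.prod γ γ) (φ := linB (∑ i, w i * v i) s) (f := Φ)
    (linB (∑ i, w i * v i) s).continuous.measurable.aemeasurable hΦ.aestronglyMeasurable
  simp only [linA_apply] at h1
  simp only [linB_apply] at h2
  rw [← h1, ← h2, e]

lemma exists_s {n : ℕ} (w v : Fin n → ℝ) (hw : ∑ i, w i ^ 2 = 1) (hv : ∑ i, v i ^ 2 = 1) :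
    ∃ s : ℝ, (∑ i, w i * v i) ^ 2 + s ^ 2 = 1 := by
  have := Finset.sum_mul_sq_le_sq_mul_sq Finset.univ w v
  rw [hw, hv] at this
  refine ⟨√(1 - (∑ i, w i * v i) ^ 2), ?_⟩
  rw [Real.sq_sqrt (by linarith)]; ring

lemma first_moment {n : ℕ} (w : Fin n → ℝ) (hw : ∑ i, w i ^ 2 = 1) (f : ℝ → ℝ)
    (hf : Measurable f) (bf : ∀ x, 0 ≤ f x ∧ f x ≤ 1) (k : Fin n) :
    ∫ x, f (∑ i, w i * x i) * x k ∂(_root_.stdGaussian n) = w k * ∫ x, f x * x ∂γ := by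
  have hv : ∑ i, (Pi.single k (1:ℝ) : Fin n → ℝ) i ^ 2 = 1 := by
    simp [Pi.single_apply, ite_pow]
  obtain ⟨s, hs⟩ := exists_s w (Pi.single k 1) hw hv
  have e := transfer w (Pi.single k 1) s hw hv hs (fun p => f p.1 * p.2)
    ((hf.comp measurable_fst).mul measurable_snd)
  have e1 : ∀ x : Fin n → ℝ, ∑ i, (Pi.single k (1:ℝ) : Fin n → ℝ) i * x i = x k := by
    intro x; simp [Pi.single_apply]
  have e2 : ∑ i, w i * (Pi.single k (1:ℝ) : Fin n → ℝ) i = w k := by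
    simp [Pi.single_apply]
  simp only [e1, e2] at e
  rw [e]
  have iff1 : Integrable (fun x => f x * x) γ := by
    refine id_integrable.bdd_mul (c := 1) hf.aestronglyMeasurable ?_
    filter_upwards with x
    rw [Real.norm_of_nonneg (bf x).1]; exact (bf x).2
  have a1 : Integrable (fun p : ℝ × ℝ => w k * (f p.1 * p.1)) (Measure.prod γ γ) :=
    (iff1.comp_fst γ).const_mul _
  have a2 : Integrable (fun p : ℝ × ℝ => s * (f p.1 * p.2)) (Measure.prod γ γ) :=
    ((bdd_integrable γ f hf bf).mul_prod id_integrable).const_mul _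
  have : ∀ p : ℝ × ℝ, f p.1 * (w k * p.1 + s * p.2) = w k * (f p.1 * p.1) + s * (f p.1 * p.2) := by
    intro p; ring
  simp_rw [this]
  rw [integral_add a1 a2, integral_const_mul, integral_const_mul,
    integral_prod_mul (fun x => f x) (fun z => z), integral_fun_fst (fun x => f x * x)]
  simp

/-- KKM-type Gaussian correlation bound for monotone functions of linear forms. -/
theorem stmt4 :
    ∃ c : ℝ, 0 < c ∧ ∀ (n : ℕ) (w v : Fin n → ℝ),
      (∑ i, w i ^ 2) = 1 → (∑ i, v i ^ 2) = 1 → 0 ≤ ∑ i, w i * v i →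
      ∀ f g : ℝ → ℝ,
        Monotone f → Monotone g →
        (∀ x : ℝ, ContinuousWithinAt f (Set.Iio x) x) →
        (∀ x : ℝ, ContinuousWithinAt g (Set.Iio x) x) →
        (∀ x : ℝ, f x ∈ Set.Icc (0 : ℝ) 1) →
        (∀ x : ℝ, g x ∈ Set.Icc (0 : ℝ) 1) →
        gaussCov n (fun x => f (∑ i, w i * x i)) (fun x => g (∑ i, v i * x i)) ≥
          c * gaussW1F n (fun x => f (∑ i, w i * x i)) (fun x => g (∑ i, v i * x i)) /
            (Real.sqrt (Real.log (Real.exp 1 /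
                gaussW1F n (fun x => f (∑ i, w i * x i)) (fun x => f (∑ i, w i * x i)))) *
             Real.sqrt (Real.log (Real.exp 1 /
                gaussW1F n (fun x => g (∑ i, v i * x i)) (fun x => g (∑ i, v i * x i))))) := by
  refine ⟨kap / 16, by linarith [kap_pos], ?_⟩
  intro n w v hw hv hρ f g hf hg _ _ bf bg
  obtain ⟨s, hs⟩ := exists_s w v hw hv
  have bf' : ∀ x, 0 ≤ f x ∧ f x ≤ 1 := fun x => bf x
  have bg' : ∀ x, 0 ≤ g x ∧ g x ≤ 1 := fun x => bg x
  have mf := hf.measurable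
  have mg := hg.measurable
  have hm := main2 _ s f g hρ hs hf hg bf' bg'
  have hc : gaussCov n (fun x => f (∑ i, w i * x i)) (fun x => g (∑ i, v i * x i)) =
      cv (Measure.prod γ γ) (fun p => f p.1) (fun p => g ((∑ i, w i * v i) * p.1 + s * p.2)) := by
    unfold gaussCov cv
    have t1 := transfer w v s hw hv hs (fun p => f p.1 * g p.2)
      ((mf.comp measurable_fst).mul (mg.comp measurable_snd))
    have t2 := transfer w v s hw hv hs (fun p => f p.1) (mf.comp measurable_fst)
    have t3 := transfer w v s hw hv hs (fun p => g p.2) (mg.comp measurable_snd)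
    simp only at t1 t2 t3
    rw [t1, t2, t3]
  have hW : ∀ (w v : Fin n → ℝ) (f g : ℝ → ℝ), (∑ i, w i ^ 2 = 1) → (∑ i, v i ^ 2 = 1) →
      Measurable f → Measurable g → (∀ x, 0 ≤ f x ∧ f x ≤ 1) → (∀ x, 0 ≤ g x ∧ g x ≤ 1) →
      gaussW1F n (fun x => f (∑ i, w i * x i)) (fun x => g (∑ i, v i * x i)) =
      (∑ i, w i * v i) * ((∫ x, f x * x ∂γ) * (∫ x, g x * x ∂γ)) := by
    intro w v f g hw hv mf mg bf bg
    unfold gaussW1F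
    rw [Finset.sum_mul]
    refine Finset.sum_congr rfl fun k _ => ?_
    rw [first_moment w hw f mf bf k, first_moment v hv g mg bg k]
    ring
  rw [hc, hW w v f g hw hv mf mg bf' bg', hW w w f f hw hw mf mf bf' bf',
    hW v v g g hv hv mg mg bg' bg']
  simp_rw [← pow_two, hw, hv, one_mul]
  refine ge_iff_le.2 (le_trans (le_of_eq ?_) hm)
  unfold hh
  rw [div_mul_div_comm]
  ring
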